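/- arXiv:1305.3543 — 3 statements merged into one kernel-verified Lean document; each statement's English description precedes it below -/
import Mathlib

section
/- Let d, m ≥ 1 and let λ = (λ_1 ≥ ⋯ ≥ λ_m ≥ 0) be a partition with λ_1 ≤ d, and let λ̃ = (λ̃_1,…,λ̃_d) be its conjugate partition (λ̃_j := #{i : λ_i ≥ j}, padded with zeros to length d). Then in the polynomial ring ℤ[y_1,…,y_d] one has det( y_i^{λ̃_j + d − j} )_{1 ≤ i,j ≤ d} = det( e_{λ_i + j − i}(y_1,…,y_d) )_{1 ≤ i,j ≤ m} · det( y_i^{d−j} )_{1 ≤ i,j ≤ d}. Equivalently, the Schur polynomial s_{λ̃}(y_1,…,y_d), defined as the bialternant quotient det(y_i^{λ̃_j+d−j})/det(y_i^{d−j}), equals the Jacobi–Trudi determinant det(e_{λ_i+j−i}(y_1,…,y_d)). -/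
open Finset MvPolynomial

/-- Elementary symmetric polynomial with an integer index: zero for negative
indices (and automatically zero for indices larger than the number of
variables). -/
noncomputable def esymmZ (d : ℕ) (r : ℤ) : MvPolynomial (Fin d) ℤ :=
  if 0 ≤ r then MvPolynomial.esymm (Fin d) ℤ r.toNat else 0

/-- The `j`-th part (counted from zero) of the conjugate partition. -/
def conjugatePart {m : ℕ} (lam : Fin m → ℕ) (j : ℕ) : ℕ :=
  #{i : Fin m | j + 1 ≤ lam i}

theorem conjugatePart_le {m : ℕ} (lam : Fin m → ℕ) (j : ℕ) : conjugatePart lam j ≤ m :=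
  (card_le_univ _).trans_eq (Fintype.card_fin m)

theorem conjugatePart_antitone {m : ℕ} (lam : Fin m → ℕ) : Antitone (conjugatePart lam) := by
  intro a b hab
  refine card_le_card fun i hi => ?_
  simp only [mem_filter, mem_univ, true_and] at hi ⊢
  omega

theorem lt_conjugatePart {m : ℕ} {lam : Fin m → ℕ} (hanti : Antitone lam) {j : ℕ} {i : Fin m}
    (h : j < lam i) : (i : ℕ) < conjugatePart lam j := by
  rw [← Nat.add_one_le_iff, ← Fin.card_Iic]
  refine card_le_card fun k hk => ?_
  have := hanti (mem_Iic.mp hk)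
  simp only [mem_filter, mem_univ, true_and]
  omega

theorem conjugatePart_le_of_le {m : ℕ} {lam : Fin m → ℕ} (hanti : Antitone lam) {j : ℕ}
    {i : Fin m} (h : lam i ≤ j) : conjugatePart lam j ≤ i := by
  rw [← Fin.card_Iio]
  refine card_le_card fun k hk => ?_
  simp only [mem_filter, mem_univ, true_and] at hk
  rw [mem_Iio]
  by_contra! hik
  have := hanti hik
  omega

/-- The sign of a permutation that is increasing on an initial block and on its complement. -/
theorem sign_eq_prod_of_strictMono_blocks {d m : ℕ} (σ : Equiv.Perm (Fin (d + m)))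
    (h₁ : StrictMono (σ ∘ Fin.castAdd m)) (h₂ : StrictMono (σ ∘ Fin.natAdd d)) :
    σ.sign = ∏ i : Fin m, ∏ j : Fin d,
      if σ (Fin.castAdd m j) < σ (Fin.natAdd d i) then 1 else -1 := by
  have key : ∀ j : Fin (d + m), ∏ i ∈ Iio j, (if σ i < σ j then (1 : ℤˣ) else -1) =
      ∏ i, if i < j then (if σ i < σ j then (1 : ℤˣ) else -1) else 1 := by
    intro j
    rw [← prod_filter]
    congr 1
    ext i
    simp
  simp_rw [Equiv.Perm.sign_eq_prod_prod_Iio, key]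
  rw [Fin.prod_univ_add]
  have hleft : ∏ j : Fin d, ∏ i, (if i < Fin.castAdd m j then
      (if σ i < σ (Fin.castAdd m j) then (1 : ℤˣ) else -1) else 1) = 1 := by
    refine prod_eq_one fun j _ => ?_
    rw [Fin.prod_univ_add, prod_eq_one, prod_eq_one, one_mul]
    · intro i _
      rw [if_neg]
      simp only [Fin.lt_def, Fin.val_natAdd, Fin.val_castAdd]
      omega
    · intro i _
      split_ifs with h h'
      · rfl
      · exact absurd (h₁ (by simpa only [Fin.lt_def, Fin.val_castAdd] using h)) h'
      · rfl
  rw [hleft, one_mul]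
  refine prod_congr rfl fun i _ => ?_
  rw [Fin.prod_univ_add]
  have hright : ∏ k : Fin m, (if Fin.natAdd d k < Fin.natAdd d i then
      (if σ (Fin.natAdd d k) < σ (Fin.natAdd d i) then (1 : ℤˣ) else -1) else 1) = 1 := by
    refine prod_eq_one fun k _ => ?_
    split_ifs with h h'
    · rfl
    · exact absurd (h₂ (by simpa using h)) h'
    · rfl
  rw [hright, mul_one]
  refine prod_congr rfl fun j _ => if_pos ?_
  simp only [Fin.lt_def, Fin.val_natAdd, Fin.val_castAdd]
  omega

theorem prod_ite_le_rev {d l : ℕ} (h : l ≤ d) :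
    ∏ j : Fin d, (if l ≤ (Fin.rev j : ℕ) then (1 : ℤˣ) else -1) = (-1) ^ l := by
  have hrev := Equiv.prod_comp Fin.revPerm
    (fun j : Fin d => if l ≤ (j : ℕ) then (1 : ℤˣ) else -1)
  simp only [Fin.revPerm_apply] at hrev
  rw [hrev, Fin.prod_univ_eq_prod_range (fun j => if l ≤ j then (1 : ℤˣ) else -1) d]
  obtain ⟨k, rfl⟩ := Nat.exists_eq_add_of_le h
  rw [prod_range_add, prod_eq_one (s := range k) (by simp), mul_one,
    prod_congr rfl (g := fun _ => (-1 : ℤˣ)), prod_const, card_range]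
  intro x hx
  rw [if_neg (by simpa using hx)]

/-- The complementary sets of exponents `λ̃_j + d - j` (in reverse order) and `d - 1 + i - λ_i`
fill up `0, …, d + m - 1`. -/
def exponentPos {d m : ℕ} (lam : Fin m → ℕ) : Fin d ⊕ Fin m → Fin (d + m) :=
  Sum.elim
    (fun j => ⟨conjugatePart lam (Fin.rev j) + j, by
      have := conjugatePart_le lam (Fin.rev j); omega⟩)
    (fun i => ⟨d + i - lam i, by omega⟩)

theorem exponentPos_inl_lt_inr_iff {d m : ℕ} {lam : Fin m → ℕ} (hanti : Antitone lam)
    (hle : ∀ i, lam i ≤ d) (j : Fin d) (i : Fin m) :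
    exponentPos (d := d) lam (Sum.inl j) < exponentPos lam (Sum.inr i) ↔
      lam i ≤ (Fin.rev j : ℕ) := by
  have := hle i
  simp only [exponentPos, Sum.elim_inl, Sum.elim_inr, Fin.lt_def]
  by_cases h : lam i ≤ (Fin.rev j : ℕ)
  · have := conjugatePart_le_of_le hanti h
    simp only [Fin.val_rev] at *
    omega
  · have := lt_conjugatePart hanti (not_le.mp h)
    simp only [Fin.val_rev] at *
    omega

theorem exponentPos_inl_strictMono {d m : ℕ} (lam : Fin m → ℕ) :
    StrictMono fun j : Fin d => exponentPos lam (Sum.inl j) := by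
  intro a b hab
  have := conjugatePart_antitone lam (Fin.rev_le_rev.mpr hab.le : (Fin.rev b : ℕ) ≤ Fin.rev a)
  simp only [exponentPos, Sum.elim_inl, Fin.lt_def] at *
  omega

theorem exponentPos_inr_strictMono {d m : ℕ} {lam : Fin m → ℕ} (hanti : Antitone lam)
    (hle : ∀ i, lam i ≤ d) :
    StrictMono fun i : Fin m => exponentPos (d := d) lam (Sum.inr i) := by
  intro a b hab
  have := hanti hab.le
  have := hle a
  simp only [exponentPos, Sum.elim_inr, Fin.lt_def] at *
  omega

theorem exponentPos_inl_ne_inr {d m : ℕ} {lam : Fin m → ℕ} (hanti : Antitone lam)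
    (hle : ∀ i, lam i ≤ d) (j : Fin d) (i : Fin m) :
    exponentPos (d := d) lam (Sum.inl j) ≠ exponentPos lam (Sum.inr i) := by
  have := hle i
  simp only [exponentPos, Sum.elim_inl, Sum.elim_inr, ne_eq, Fin.mk.injEq]
  rcases le_or_gt (lam i) (Fin.rev j : ℕ) with h | h
  · have := conjugatePart_le_of_le hanti h
    simp only [Fin.val_rev] at *
    omega
  · have := lt_conjugatePart hanti h
    simp only [Fin.val_rev] at *
    omega

theorem exponentPos_bijective {d m : ℕ} {lam : Fin m → ℕ} (hanti : Antitone lam)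
    (hle : ∀ i, lam i ≤ d) : Function.Bijective (exponentPos (d := d) lam) := by
  rw [Fintype.bijective_iff_injective_and_card]
  refine ⟨?_, by simp⟩
  rintro (a | a) (b | b) h
  · rw [(exponentPos_inl_strictMono lam).injective h]
  · exact absurd h (exponentPos_inl_ne_inr hanti hle a b)
  · exact absurd h.symm (exponentPos_inl_ne_inr hanti hle b a)
  · rw [(exponentPos_inr_strictMono hanti hle).injective h]

/-- `exponentPos` as an equivalence. -/
noncomputable def exponentEquiv {d m : ℕ} {lam : Fin m → ℕ} (hanti : Antitone lam)
    (hle : ∀ i, lam i ≤ d) : Fin d ⊕ Fin m ≃ Fin (d + m) :=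
  Equiv.ofBijective _ (exponentPos_bijective hanti hle)

theorem sign_exponentEquiv {d m : ℕ} {lam : Fin m → ℕ} (hanti : Antitone lam)
    (hle : ∀ i, lam i ≤ d) :
    Equiv.Perm.sign (finSumFinEquiv.symm.trans (exponentEquiv hanti hle)) =
      ∏ i, (-1) ^ lam i := by
  rw [sign_eq_prod_of_strictMono_blocks]
  · refine prod_congr rfl fun i _ => ?_
    rw [← prod_ite_le_rev (hle i)]
    refine prod_congr rfl fun j _ => ?_
    simp [exponentEquiv, exponentPos_inl_lt_inr_iff hanti hle]
  · simpa [exponentEquiv, Function.comp_def] using exponentPos_inl_strictMono lam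
  · simpa [exponentEquiv, Function.comp_def] using exponentPos_inr_strictMono hanti hle

/-- The polynomial `∏ (T - y_l)` over `ℤ[y_1, …, y_d]`. -/
noncomputable def rootsPoly (d : ℕ) : Polynomial (MvPolynomial (Fin d) ℤ) :=
  ∏ l : Fin d, (Polynomial.X - Polynomial.C (X l))

theorem rootsPoly_monic (d : ℕ) : (rootsPoly d).Monic :=
  Polynomial.monic_prod_of_monic _ _ fun _ _ => Polynomial.monic_X_sub_C _

theorem rootsPoly_natDegree (d : ℕ) : (rootsPoly d).natDegree = d := by
  simp [rootsPoly, Polynomial.natDegree_finsetProd_X_sub_C_eq_card]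

theorem rootsPoly_eval (d : ℕ) (i : Fin d) : (rootsPoly d).eval (X i) = 0 := by
  rw [rootsPoly, Polynomial.eval_prod]
  exact prod_eq_zero (mem_univ i) (by simp)

theorem rootsPoly_coeff {d k : ℕ} (h : k ≤ d) :
    (rootsPoly d).coeff k = (-1) ^ (d - k) * esymm (Fin d) ℤ (d - k) := by
  have := Multiset.prod_X_sub_C_coeff ((univ : Finset (Fin d)).val.map (X (R := ℤ))) (k := k)
    (by simpa using h)
  simpa [rootsPoly, esymm_eq_multiset_esymm, Finset.prod, Multiset.map_map, Function.comp_def]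
    using this

theorem esymmZ_eq_zero_of_lt {d : ℕ} {r : ℤ} (h : (d : ℤ) < r) : esymmZ d r = 0 := by
  rw [esymmZ, if_pos (by omega), esymm, powersetCard_eq_empty.mpr, sum_empty]
  simp only [card_univ, Fintype.card_fin]
  omega

theorem rootsPoly_mul_X_pow_coeff {d l i k : ℕ} (hl : l ≤ d) :
    (rootsPoly d * Polynomial.X ^ k).coeff (d + i - l) =
      (-1) ^ (l + i) * ((-1) ^ k * esymmZ d ((l : ℤ) + k - i)) := by
  rw [Polynomial.coeff_mul_X_pow']
  split_ifs with h
  · by_cases h' : d + i - l - k ≤ d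
    · rw [rootsPoly_coeff h', esymmZ, if_pos (by omega),
        show d - (d + i - l - k) = ((l : ℤ) + k - i).toNat by omega, ← mul_assoc, ← pow_add]
      congr 1
      refine neg_one_pow_congr ?_
      grind
    · rw [Polynomial.coeff_eq_zero_of_natDegree_lt (by rw [rootsPoly_natDegree]; omega), esymmZ,
        if_neg (by omega), mul_zero, mul_zero]
  · rw [esymmZ_eq_zero_of_lt (by omega), mul_zero, mul_zero]

/-- The basis `1, …, T^{d-1}, p, p T, …, p T^{m-1}` of polynomials of degree less than `d + m`,
where `p = ∏ (T - y_l)`. -/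
noncomputable def remainderBasis (d m : ℕ) (c : Fin (d + m)) :
    Polynomial (MvPolynomial (Fin d) ℤ) :=
  Fin.addCases (fun j : Fin d => Polynomial.X ^ (j : ℕ))
    (fun k : Fin m => rootsPoly d * Polynomial.X ^ (k : ℕ)) c

theorem remainderBasis_monic (d m : ℕ) (c : Fin (d + m)) : (remainderBasis d m c).Monic := by
  refine Fin.addCases (fun j => ?_) (fun k => ?_) c
  · simp [remainderBasis, Polynomial.monic_X_pow]
  · simpa [remainderBasis] using (rootsPoly_monic d).mul (Polynomial.monic_X_pow _)

theorem remainderBasis_natDegree (d m : ℕ) (c : Fin (d + m)) :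
    (remainderBasis d m c).natDegree = c := by
  refine Fin.addCases (fun j => ?_) (fun k => ?_) c
  · simp [remainderBasis]
  · simp [remainderBasis, (rootsPoly_monic d).natDegree_mul (Polynomial.monic_X_pow _),
      rootsPoly_natDegree]

/-- The coefficient matrix of `remainderBasis`. -/
noncomputable def remainderMatrix (d m : ℕ) :
    Matrix (Fin (d + m)) (Fin (d + m)) (MvPolynomial (Fin d) ℤ) :=
  Matrix.of fun c a => (remainderBasis d m a).coeff c

theorem det_remainderMatrix (d m : ℕ) : (remainderMatrix d m).det = 1 :=
  Matrix.det_matrixOfPolynomials _ (remainderBasis_natDegree d m) (remainderBasis_monic d m)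

/-- The power matrix of the variables, completed by the coordinate rows at the exponents
`d - 1 + i - λ_i`. -/
noncomputable def completedPowerMatrix {d m : ℕ} (lam : Fin m → ℕ) :
    Matrix (Fin d ⊕ Fin m) (Fin (d + m)) (MvPolynomial (Fin d) ℤ) :=
  Matrix.of fun a c => Sum.elim (fun i => X i ^ (c : ℕ))
    (fun i => if c = exponentPos lam (Sum.inr i) then 1 else 0) a

theorem completedPowerMatrix_submatrix {d m : ℕ} {lam : Fin m → ℕ} (hanti : Antitone lam)
    (hle : ∀ i, lam i ≤ d) :
    (completedPowerMatrix lam).submatrix id (exponentEquiv hanti hle) = Matrix.fromBlocks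
      (Matrix.of fun i j : Fin d => X i ^ (conjugatePart lam (Fin.rev j) + j))
      (Matrix.of fun (i : Fin d) (k : Fin m) => X i ^ (d + k - lam k)) 0 1 := by
  refine Matrix.ext fun a b => ?_
  rcases a with i | i <;> rcases b with j | j
  · simp [completedPowerMatrix, exponentEquiv, exponentPos]
  · simp [completedPowerMatrix, exponentEquiv, exponentPos]
  · simp [completedPowerMatrix, exponentEquiv, exponentPos_inl_ne_inr hanti hle]
  · simp [completedPowerMatrix, exponentEquiv, Matrix.one_apply,
      (exponentPos_inr_strictMono hanti hle).injective.eq_iff, eq_comm]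

theorem completedPowerMatrix_mul {d m : ℕ} {lam : Fin m → ℕ} (hle : ∀ i, lam i ≤ d) :
    ((completedPowerMatrix lam).submatrix finSumFinEquiv.symm id *
        remainderMatrix d m).submatrix finSumFinEquiv finSumFinEquiv =
      Matrix.fromBlocks (Matrix.of fun i j : Fin d => X i ^ (j : ℕ)) 0
        (Matrix.of fun (i : Fin m) (j : Fin d) =>
          (Polynomial.X ^ (j : ℕ) : Polynomial (MvPolynomial (Fin d) ℤ)).coeff (d + i - lam i))
        (Matrix.of fun i k : Fin m => (-1) ^ (lam i + i : ℕ) *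
          ((-1) ^ (k : ℕ) * esymmZ d ((lam i : ℤ) + (k : ℤ) - (i : ℤ)))) := by
  have hinl : ∀ (i : Fin d) (a : Fin (d + m)), ∑ c : Fin (d + m),
      completedPowerMatrix lam (Sum.inl i) c * remainderMatrix d m c a =
        (remainderBasis d m a).eval (X i) := by
    intro i a
    rw [Polynomial.eval_eq_sum_range' (n := d + m)
      (by rw [remainderBasis_natDegree]; exact a.isLt), ← Fin.sum_univ_eq_sum_range
      (fun c => (remainderBasis d m a).coeff c * X i ^ c)]
    simp [completedPowerMatrix, remainderMatrix, mul_comm]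
  have hinr : ∀ (i : Fin m) (a : Fin (d + m)), ∑ c : Fin (d + m),
      completedPowerMatrix lam (Sum.inr i) c * remainderMatrix d m c a =
        (remainderBasis d m a).coeff (d + i - lam i) := by
    intro i a
    rw [sum_eq_single (exponentPos lam (Sum.inr i))]
    · simp [completedPowerMatrix, remainderMatrix, exponentPos]
    · intro c _ hc
      simp [completedPowerMatrix, hc]
    · simp
  refine Matrix.ext fun a b => ?_
  rcases a with i | i <;> rcases b with j | j
  · simp [Matrix.mul_apply, hinl, remainderBasis]
  · simp [Matrix.mul_apply, hinl, remainderBasis, rootsPoly_eval]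
  · simp [Matrix.mul_apply, hinr, remainderBasis]
  · simp [Matrix.mul_apply, hinr, remainderBasis, rootsPoly_mul_X_pow_coeff (hle i)]

theorem det_signed_esymmZ {d m : ℕ} (lam : Fin m → ℕ) :
    (Matrix.of fun i k : Fin m => (-1) ^ (lam i + i : ℕ) *
      ((-1) ^ (k : ℕ) * esymmZ d ((lam i : ℤ) + (k : ℤ) - (i : ℤ)))).det =
    (∏ i, (-1) ^ lam i) *
      (Matrix.of fun i k : Fin m => esymmZ d ((lam i : ℤ) + (k : ℤ) - (i : ℤ))).det := by
  have h := Matrix.det_mul_column (fun i : Fin m => (-1) ^ (lam i + i : ℕ))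
    (Matrix.of fun i k : Fin m =>
      (-1) ^ (k : ℕ) * esymmZ d ((lam i : ℤ) + (k : ℤ) - (i : ℤ)))
  have h' := Matrix.det_mul_row (fun k : Fin m => (-1) ^ (k : ℕ))
    (Matrix.of fun i k : Fin m => esymmZ d ((lam i : ℤ) + (k : ℤ) - (i : ℤ)))
  simp only [Matrix.of_apply] at h h'
  rw [h, h', ← mul_assoc, ← prod_mul_distrib]
  congr 1
  refine prod_congr rfl fun i _ => ?_
  rw [← pow_add]
  exact neg_one_pow_congr (by grind)

theorem det_pow_conjugatePart_rev {d m : ℕ} {lam : Fin m → ℕ} (hanti : Antitone lam)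
    (hle : ∀ i, lam i ≤ d) :
    (Matrix.of fun i j : Fin d => (X i : MvPolynomial (Fin d) ℤ) ^
      (conjugatePart lam (Fin.rev j) + (j : ℕ))).det =
    (Matrix.of fun i j : Fin m => esymmZ d ((lam i : ℤ) + (j : ℤ) - (i : ℤ))).det *
      (Matrix.of fun i j : Fin d => (X i : MvPolynomial (Fin d) ℤ) ^ (j : ℕ)).det := by
  have hpow := congrArg Matrix.det (completedPowerMatrix_submatrix hanti hle)
  have hmul := congrArg Matrix.det (completedPowerMatrix_mul hle)
  rw [Matrix.det_fromBlocks_zero₂₁, Matrix.det_one, mul_one] at hpow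
  rw [Matrix.det_fromBlocks_zero₁₂, det_signed_esymmZ] at hmul
  let M := (completedPowerMatrix (d := d) lam).submatrix finSumFinEquiv.symm id
  have hpow' := Matrix.det_permute' (finSumFinEquiv.symm.trans (exponentEquiv hanti hle)) M
  have hsub : M.submatrix id (finSumFinEquiv.symm.trans (exponentEquiv hanti hle)) =
      ((completedPowerMatrix lam).submatrix id (exponentEquiv hanti hle)).submatrix
        finSumFinEquiv.symm finSumFinEquiv.symm := rfl
  rw [hsub, Matrix.det_submatrix_equiv_self, hpow, sign_exponentEquiv] at hpow'
  rw [Matrix.det_submatrix_equiv_self, Matrix.det_mul, det_remainderMatrix, mul_one] at hmul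
  have hsq : (∏ i, (-1 : MvPolynomial (Fin d) ℤ) ^ lam i) * ∏ i, (-1) ^ lam i = 1 := by
    rw [← prod_mul_distrib]
    exact prod_eq_one fun i _ => by rw [← mul_pow]; simp
  push_cast at hpow'
  rw [hpow', hmul]
  linear_combination (Matrix.of fun i j : Fin m =>
    esymmZ d ((lam i : ℤ) + (j : ℤ) - (i : ℤ))).det *
      (Matrix.of fun i j : Fin d => (X i : MvPolynomial (Fin d) ℤ) ^ (j : ℕ)).det * hsq

/-- the bialternant determinant for the conjugate partition equals
the Jacobi–Trudi determinant in elementary symmetric polynomials times the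
Vandermonde determinant: `det(y_i^{λ̃_j + d - j}) = det(e_{λ_i + j - i}) ·
det(y_i^{d-j})` in `ℤ[y_1, …, y_d]`. -/
theorem bialternant_eq_jacobiTrudi_mul_vandermonde
    (d m : ℕ) (hd : 1 ≤ d) (hm : 1 ≤ m)
    (lam : Fin m → ℕ) (hanti : Antitone lam) (hle : lam ⟨0, hm⟩ ≤ d) :
    Matrix.det (Matrix.of fun i j : Fin d =>
      (MvPolynomial.X i : MvPolynomial (Fin d) ℤ) ^
        ((Finset.univ.filter (fun i' : Fin m => (j : ℕ) + 1 ≤ lam i')).card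
          + (d - 1 - (j : ℕ)))) =
    Matrix.det (Matrix.of fun i j : Fin m =>
        esymmZ d ((lam i : ℤ) + (j : ℤ) - (i : ℤ))) *
    Matrix.det (Matrix.of fun i j : Fin d =>
      (MvPolynomial.X i : MvPolynomial (Fin d) ℤ) ^ (d - 1 - (j : ℕ))) := by
  have hle' : ∀ i, lam i ≤ d := fun i => (hanti (Fin.mk_le_of_le_val (Nat.zero_le _))).trans hle
  have hB := Matrix.det_permute' Fin.revPerm (Matrix.of fun i j : Fin d =>
    (X i : MvPolynomial (Fin d) ℤ) ^ (conjugatePart lam (Fin.rev j) + (j : ℕ)))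
  have hV := Matrix.det_permute' Fin.revPerm (Matrix.of fun i j : Fin d =>
    (X i : MvPolynomial (Fin d) ℤ) ^ (j : ℕ))
  have hrev : ∀ j : Fin d, d - 1 - (j : ℕ) = Fin.rev j := fun j => by rw [Fin.val_rev]; omega
  simp only [hrev]
  simp only [Matrix.submatrix, Matrix.of_apply, id_eq, Fin.revPerm_apply, Fin.rev_rev] at hB hV
  rw [hV, mul_left_comm, ← det_pow_conjugatePart_rev hanti hle', ← hB]
  rfl
end

section
/- Work in R := ℤ[x_1,…,x_n, y_1,…,y_n]. For r ≥ 0 define ξ_r := ∑_{i=0}^r e_i(x_1,…,x_n) · h_{r−i}(y_1,…,y_n), and set ξ_r = 0 for r < 0. Let J_n ⊆ R be the ideal generated by the n elements e_i(x_1²,…,x_n²) − e_i(y_1²,…,y_n²) for 1 ≤ i ≤ n. Then for every integer r ≥ 1, ξ_r² + 2 ∑_{i=1}^r (−1)^i ξ_{r+i} ξ_{r−i} ∈ J_n. (This establishes that the geometrization map π_n, which sends the Schur Q-function generator q_r(X) to ξ_r, is a well-defined ring homomorphism Γ[Y,Z] → ℤ[x,y]/J_n.) -/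
open Finset MvPolynomial

/-- The ambient polynomial ring `ℤ[x_1,…,x_n,y_1,…,y_n]`, with the `x`
variables indexed by `Sum.inl` and the `y` variables by `Sum.inr`. -/
abbrev XYRing (n : ℕ) := MvPolynomial (Fin n ⊕ Fin n) ℤ

/-- `e_i(x_1,…,x_n)` inside `ℤ[x,y]`. -/
noncomputable def ex (n i : ℕ) : XYRing n :=
  MvPolynomial.aeval (fun j : Fin n => (MvPolynomial.X (Sum.inl j) : XYRing n))
    (MvPolynomial.esymm (Fin n) ℤ i)

/-- `h_j(y_1,…,y_n)` inside `ℤ[x,y]`. -/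
noncomputable def hy (n j : ℕ) : XYRing n :=
  MvPolynomial.aeval (fun i : Fin n => (MvPolynomial.X (Sum.inr i) : XYRing n))
    (MvPolynomial.hsymm (Fin n) ℤ j)

/-- `ξ_r = ∑_{i=0}^r e_i(x) h_{r-i}(y)`. -/
noncomputable def xiPoly (n r : ℕ) : XYRing n :=
  ∑ i ∈ Finset.range (r + 1), ex n i * hy n (r - i)

/-- `e_i(x_1²,…,x_n²)` inside `ℤ[x,y]`. -/
noncomputable def exSq (n i : ℕ) : XYRing n :=
  MvPolynomial.aeval (fun j : Fin n => (MvPolynomial.X (Sum.inl j) : XYRing n) ^ 2)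
    (MvPolynomial.esymm (Fin n) ℤ i)

/-- `e_i(y_1²,…,y_n²)` inside `ℤ[x,y]`. -/
noncomputable def eySq (n i : ℕ) : XYRing n :=
  MvPolynomial.aeval (fun j : Fin n => (MvPolynomial.X (Sum.inr j) : XYRing n) ^ 2)
    (MvPolynomial.esymm (Fin n) ℤ i)

/-- The ideal `J_n` generated by `e_i(x²) − e_i(y²)` for `1 ≤ i ≤ n`. -/
noncomputable def Jideal (n : ℕ) : Ideal (XYRing n) :=
  Ideal.span ((fun i => exSq n i - eySq n i) '' Set.Icc 1 n)

/-- The generating series of the complete homogeneous symmetric polynomials is a product of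
geometric series. -/
theorem mk_aeval_hsymm {σ S : Type*} [Fintype σ] [DecidableEq σ] [CommRing S] (g : σ → S) :
    PowerSeries.mk (fun k => aeval g (hsymm σ ℤ k)) =
      ∏ i, PowerSeries.mk (fun k => g i ^ k) := by
  ext k
  rw [PowerSeries.coeff_prod, PowerSeries.coeff_mk, hsymm, map_sum]
  refine Finset.sum_bij' (fun s _ => Multiset.toFinsupp (s : Multiset σ))
    (fun l hl => ⟨Finsupp.toMultiset l, ?_⟩) ?_ ?_ ?_ ?_ ?_
  · rw [Finsupp.card_toMultiset]
    rw [mem_finsuppAntidiag'] at hl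
    exact hl.1
  · intro s _
    rw [mem_finsuppAntidiag']
    exact ⟨(Multiset.toFinsupp_sum_eq (s : Multiset σ)).trans s.2, subset_univ _⟩
  · exact fun _ _ => mem_univ _
  · intro s _
    exact Subtype.ext (Multiset.toFinsupp_toMultiset _)
  · intro l _
    exact Finsupp.toMultiset_toFinsupp l
  · intro s _
    simp only [PowerSeries.coeff_mk, Multiset.toFinsupp_apply]
    rw [map_multiset_prod, Multiset.map_map, Finset.prod_multiset_map_count]
    simp only [Function.comp_apply, aeval_X]
    refine Finset.prod_subset (subset_univ _) fun i _ hi => ?_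
    rw [Multiset.count_eq_zero.2 (by simpa using hi), pow_zero]

/-- The product `∏ (1 + g i * t)` expands in the elementary symmetric polynomials. -/
theorem prod_one_add_mul_eq_sum_esymm {σ S T : Type*} [Fintype σ] [CommRing S] [CommRing T]
    [Algebra S T] (g : σ → S) (t : T) :
    ∏ i, (1 + algebraMap S T (g i) * t) =
      ∑ k ∈ range (Fintype.card σ + 1), algebraMap S T (aeval g (esymm σ ℤ k)) * t ^ k := by
  classical
  rw [Finset.prod_one_add, Finset.sum_powerset, card_univ]
  refine Finset.sum_congr rfl fun k _ => ?_
  rw [esymm, map_sum, map_sum, Finset.sum_mul]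
  refine Finset.sum_congr rfl fun s hs => ?_
  rw [Finset.prod_mul_distrib, prod_const, (mem_powersetCard.1 hs).2]
  simp

/-- The generating series of the elementary symmetric polynomials. -/
theorem mk_aeval_esymm {σ S : Type*} [Fintype σ] [CommRing S] (g : σ → S) :
    PowerSeries.mk (fun k => aeval g (esymm σ ℤ k)) =
      ∏ i, (1 + PowerSeries.C (g i) * PowerSeries.X) := by
  have h := prod_one_add_mul_eq_sum_esymm g (PowerSeries.X : PowerSeries S)
  simp only [PowerSeries.algebraMap_eq] at h
  rw [h]
  ext k
  simp only [PowerSeries.coeff_mk, map_sum, PowerSeries.coeff_C_mul, PowerSeries.coeff_X_pow,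
    mul_ite, mul_one, mul_zero, Finset.sum_ite_eq, mem_range]
  split_ifs with hk
  · rfl
  · rw [esymm, powersetCard_eq_empty.2 (by rw [card_univ]; omega), sum_empty, map_zero]

/-- A sum over `range (2 * r + 1)` folded around its middle term. -/
theorem sum_range_two_mul_add_one {M : Type*} [AddCommMonoid M] (f : ℕ → M) (r : ℕ) :
    ∑ k ∈ range (2 * r + 1), f k = f r + ∑ i ∈ Icc 1 r, (f (r + i) + f (r - i)) := by
  have h : Icc 1 r = Ico 1 (r + 1) := by ext; simp
  rw [show 2 * r + 1 = r + (r + 1) by ring, Finset.sum_range_add, Finset.sum_range_succ',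
    ← Finset.sum_range_reflect f r, h, Finset.sum_Ico_eq_sum_range, Finset.sum_add_distrib,
    add_tsub_cancel_right, add_zero, add_comm, add_comm _ (f r), add_assoc]
  congr 2
  · exact Finset.sum_congr rfl fun k _ => by rw [add_comm 1 k]
  · exact Finset.sum_congr rfl fun k _ => by rw [Nat.sub_sub]

/-- The even coefficients of `F(X) F(-X)`. -/
theorem coeff_two_mul_mul_rescale_neg_one {S : Type*} [CommRing S] (f : ℕ → S) (r : ℕ) :
    PowerSeries.coeff (2 * r) (PowerSeries.mk f * PowerSeries.rescale (-1) (PowerSeries.mk f)) =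
      (-1) ^ r * (f r ^ 2 + 2 * ∑ i ∈ Icc 1 r, (-1) ^ i * f (r + i) * f (r - i)) := by
  rw [PowerSeries.coeff_mul, Finset.Nat.sum_antidiagonal_eq_sum_range_succ_mk,
    sum_range_two_mul_add_one, mul_add, Finset.mul_sum, Finset.mul_sum]
  simp only [PowerSeries.coeff_rescale, PowerSeries.coeff_mk]
  congr 1
  · rw [show 2 * r - r = r by omega]
    ring
  · refine Finset.sum_congr rfl fun i hi => ?_
    obtain ⟨j, rfl⟩ := Nat.exists_eq_add_of_le (mem_Icc.1 hi).2
    rw [show 2 * (i + j) - (i + j + i) = j by omega, show i + j - i = j by omega,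
      show 2 * (i + j) - j = i + j + i by omega]
    have h : ((-1 : S) ^ i) ^ 2 = 1 := by rw [← pow_mul, mul_comm, pow_mul]; simp
    simp only [pow_add]
    linear_combination (-(-1 : S) ^ j * f (i + j + i) * f j) * h

theorem sq_add_two_mul_sum_eq_zero {S : Type*} [CommRing S] {f : ℕ → S}
    (hf : PowerSeries.mk f * PowerSeries.rescale (-1) (PowerSeries.mk f) = 1) {r : ℕ}
    (hr : 1 ≤ r) : f r ^ 2 + 2 * ∑ i ∈ Icc 1 r, (-1) ^ i * f (r + i) * f (r - i) = 0 := by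
  have h := coeff_two_mul_mul_rescale_neg_one f r
  rw [hf, PowerSeries.coeff_one, if_neg (by omega)] at h
  exact (isUnit_one.neg.pow r).mul_right_eq_zero.1 h.symm

/-- Changing the sign of the variable in `∏ (1 + g i X)` and multiplying gives a series in the
elementary symmetric polynomials of the squares. -/
theorem prod_mul_rescale_neg_one {σ S : Type*} [Fintype σ] [CommRing S] (g : σ → S) :
    (∏ i, (1 + PowerSeries.C (g i) * PowerSeries.X)) *
        PowerSeries.rescale (-1) (∏ i, (1 + PowerSeries.C (g i) * PowerSeries.X)) =
      ∑ k ∈ range (Fintype.card σ + 1),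
        PowerSeries.C (aeval (fun i => g i ^ 2) (esymm σ ℤ k)) * (-PowerSeries.X ^ 2) ^ k := by
  have h := prod_one_add_mul_eq_sum_esymm (fun i => g i ^ 2) (-PowerSeries.X ^ 2 : PowerSeries S)
  simp only [PowerSeries.algebraMap_eq] at h
  rw [← h, map_prod, ← Finset.prod_mul_distrib]
  refine Finset.prod_congr rfl fun i _ => ?_
  have hC : PowerSeries.rescale (-1 : S) (PowerSeries.C (g i)) = PowerSeries.C (g i) := by
    ext k
    rw [PowerSeries.coeff_rescale, PowerSeries.coeff_C]
    split_ifs with hk <;> simp [hk]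
  rw [map_add, map_mul, map_one, PowerSeries.rescale_neg_one_X, hC, map_pow]
  ring

theorem geom_mul_one_sub {S : Type*} [CommRing S] (a : S) :
    PowerSeries.mk (fun k => a ^ k) * (1 - PowerSeries.C a * PowerSeries.X) = 1 := by
  have h := congrArg (PowerSeries.rescale a) (PowerSeries.mk_one_mul_one_sub_eq_one S)
  rw [map_mul, map_sub, map_one, PowerSeries.rescale_X, PowerSeries.rescale_mk] at h
  simpa using h

/-- If the elementary symmetric polynomials of the squares of `a` and `b` agree, then the series
`Q = ∏ (1 + a i X) / (1 - b i X)` satisfies `Q(X) Q(-X) = 1`. -/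
theorem mul_rescale_neg_one_eq_one {σ S : Type*} [Fintype σ] [DecidableEq σ] [CommRing S]
    (a b : σ → S)
    (hab : ∀ k ≤ Fintype.card σ, aeval (fun i => a i ^ 2) (esymm σ ℤ k) =
      aeval (fun i => b i ^ 2) (esymm σ ℤ k)) :
    (PowerSeries.mk (fun k => aeval a (esymm σ ℤ k)) *
        PowerSeries.mk (fun k => aeval b (hsymm σ ℤ k))) *
      PowerSeries.rescale (-1) (PowerSeries.mk (fun k => aeval a (esymm σ ℤ k)) *
        PowerSeries.mk (fun k => aeval b (hsymm σ ℤ k))) = 1 := by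
  have hE := prod_mul_rescale_neg_one a
  rw [Finset.sum_congr rfl fun k hk => by
    rw [hab k (Nat.lt_succ_iff.1 (mem_range.1 hk))]] at hE
  have hD := prod_mul_rescale_neg_one (fun i => -b i)
  simp only [neg_sq] at hD
  rw [← hD, ← mk_aeval_esymm a] at hE
  have hH : PowerSeries.mk (fun k => aeval b (hsymm σ ℤ k)) *
      ∏ i, (1 + PowerSeries.C (-b i) * PowerSeries.X) = 1 := by
    rw [mk_aeval_hsymm, ← Finset.prod_mul_distrib]
    refine Finset.prod_eq_one fun i _ => ?_
    rw [map_neg, neg_mul, ← sub_eq_add_neg, geom_mul_one_sub]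
  have hH' := congrArg (PowerSeries.rescale (-1 : S)) hH
  rw [map_mul, map_one] at hH'
  rw [map_mul, mul_mul_mul_comm, hE, mul_mul_mul_comm, mul_comm _ (PowerSeries.mk _), hH,
    mul_comm _ (PowerSeries.rescale _ (PowerSeries.mk _)), hH', mul_one]

theorem aeval_ringHom_comp {σ R S : Type*} [CommRing R] [CommRing S] (φ : R →+* S) (g : σ → R)
    (p : MvPolynomial σ ℤ) : aeval (fun i => φ (g i)) p = φ (aeval g p) :=
  (comp_aeval_apply g φ.toIntAlgHom p).symm

theorem mk_xiPoly {n : ℕ} {S : Type*} [CommRing S] (φ : XYRing n →+* S) :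
    PowerSeries.mk (fun k => φ (xiPoly n k)) =
      PowerSeries.mk (fun k => aeval (fun i => φ (X (Sum.inl i))) (esymm (Fin n) ℤ k)) *
        PowerSeries.mk (fun k => aeval (fun i => φ (X (Sum.inr i))) (hsymm (Fin n) ℤ k)) := by
  ext k
  rw [PowerSeries.coeff_mul, Finset.Nat.sum_antidiagonal_eq_sum_range_succ_mk]
  simp only [xiPoly, ex, hy, aeval_ringHom_comp, map_sum, map_mul, PowerSeries.coeff_mk,
    Nat.succ_eq_add_one]
  rfl

/-- The relations hold in the image of any homomorphism identifying the elementary symmetric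
polynomials of the squares. -/
theorem map_xiPoly_relation {n : ℕ} {S : Type*} [CommRing S] (φ : XYRing n →+* S)
    (hφ : ∀ k ≤ n, φ (exSq n k) = φ (eySq n k)) {r : ℕ} (hr : 1 ≤ r) :
    φ (xiPoly n r ^ 2 + 2 * ∑ i ∈ Icc 1 r,
      (-1 : XYRing n) ^ i * xiPoly n (r + i) * xiPoly n (r - i)) = 0 := by
  have h := mul_rescale_neg_one_eq_one
    (fun i : Fin n => φ (X (Sum.inl i))) (fun i => φ (X (Sum.inr i))) fun k hk => by
      simp only [← map_pow]
      rw [aeval_ringHom_comp φ, aeval_ringHom_comp φ]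
      exact hφ k (by rwa [Fintype.card_fin] at hk)
  rw [← mk_xiPoly] at h
  have h2 : φ 2 = 2 := map_ofNat φ 2
  simpa [h2] using sq_add_two_mul_sum_eq_zero h hr

/-- `ξ_r² + 2 ∑_{i=1}^r (−1)^i ξ_{r+i} ξ_{r−i} ∈ J_n` for every
`r ≥ 1`; this makes the geometrization map `π_n` well defined. -/
theorem xiPoly_relations_mem_Jideal (n r : ℕ) (hr : 1 ≤ r) :
    xiPoly n r ^ 2 +
      2 * ∑ i ∈ Finset.Icc 1 r,
        (-1 : XYRing n) ^ i * xiPoly n (r + i) * xiPoly n (r - i) ∈ Jideal n := by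
  refine Ideal.Quotient.eq_zero_iff_mem.1 (map_xiPoly_relation _ (fun k hk => ?_) hr)
  rcases Nat.eq_zero_or_pos k with rfl | hk0
  · simp only [exSq, eySq, esymm_zero, map_one]
  · exact Ideal.Quotient.eq.2 (Ideal.subset_span ⟨k, ⟨hk0, hk⟩, rfl⟩)
end

section
/- Model the group W̃_n as the group of permutations w of {−n,…,−1,1,…,n} satisfying w(−a) = −w(a) for all a and having an even number of indices i ∈ {1,…,n} with w(i) < 0; write w_i := w(i). Fix 1 ≤ k ≤ n−1. Call w ∈ W̃_n k-Grassmannian if, for k ≥ 2, |w_1| < w_2 < ⋯ < w_k and w_{k+1} < w_{k+2} < ⋯ < w_n, and, for k = 1, w_2 < w_3 < ⋯ < w_n. Then the set of k-Grassmannian elements of W̃_n is in bijection with the set of typed k-strict partitions whose Young diagram fits inside an (n−k) × (n+k−1) rectangle (at most n−k parts, largest part at most n+k−1). -/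
/-- The group `W̃_n`, modeled as permutations `w` of `ℤ` with `w(−a) = −w(a)`
for all `a`, `w(a) = a` whenever `|a| > n`, and an even number of indices
`i ∈ {1,…,n}` with `w(i) < 0`. -/
def EvenSignedPerms (n : ℕ) : Set (Equiv.Perm ℤ) :=
  {w | (∀ a : ℤ, w (-a) = -w a) ∧ (∀ a : ℤ, (n : ℤ) < |a| → w a = a) ∧
    Even (((Finset.Icc (1 : ℤ) (n : ℤ)).filter (fun i => w i < 0)).card)}

/-- `w ∈ W̃_n` is `k`-Grassmannian (for `1 ≤ k ≤ n−1`): for `k ≥ 2`,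
`|w_1| < w_2 < ⋯ < w_k` and `w_{k+1} < ⋯ < w_n`; for `k = 1`, just
`w_2 < w_3 < ⋯ < w_n`. -/
def IsKGrassmannianD (n k : ℕ) (w : Equiv.Perm ℤ) : Prop :=
  (2 ≤ k → |w 1| < w 2) ∧
    (∀ i : ℤ, 2 ≤ i → i + 1 ≤ (k : ℤ) → w i < w (i + 1)) ∧
    ∀ i : ℤ, (k : ℤ) + 1 ≤ i → i + 1 ≤ (n : ℤ) → w i < w (i + 1)

/-- Typed `k`-strict partitions fitting in the `(n−k) × (n+k−1)` rectangle:
pairs `(λ, t)` with `λ` a `k`-strict partition with at most `n−k` parts and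
largest part at most `n+k−1`, and `t ∈ {0,1,2}` with `t > 0` iff some part of
`λ` equals `k`. -/
def TypedKStrictRect (n k : ℕ) (p : (Fin (n - k) → ℕ) × ℕ) : Prop :=
  Antitone p.1 ∧ (∀ i j : Fin (n - k), i ≠ j → k < p.1 i → p.1 i ≠ p.1 j) ∧
    (∀ i, p.1 i ≤ n + k - 1) ∧ p.2 ≤ 2 ∧ (0 < p.2 ↔ ∃ i, p.1 i = k)

/-- The `k`-strict partitions with at most `m` parts, all of them at most `b`. -/
def KStrictBox (k m b : ℕ) : Set (Fin m → ℕ) :=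
  {p | Antitone p ∧ (∀ i j : Fin m, i ≠ j → k < p i → p i ≠ p j) ∧ ∀ i, p i ≤ b}

/-- The partitions in `KStrictBox k m b` having a part equal to `k`. -/
def KStrictBoxWithPart (k m b : ℕ) : Set (Fin m → ℕ) :=
  {p | p ∈ KStrictBox k m b ∧ ∃ i, p i = k}

theorem KStrictBox.finite (k m b : ℕ) : (KStrictBox k m b).Finite :=
  (Set.Finite.pi' fun _ : Fin m => Set.finite_Iic b).subset fun _ hp i => hp.2.2 i

theorem KStrictBoxWithPart.finite (k m b : ℕ) : (KStrictBoxWithPart k m b).Finite :=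
  (KStrictBox.finite k m b).subset fun _ hp => hp.1

theorem cons_mem_kStrictBox {k m b a : ℕ} {p : Fin m → ℕ} :
    (Fin.cons a p : Fin (m + 1) → ℕ) ∈ KStrictBox k (m + 1) b ↔
      a ≤ b ∧ p ∈ KStrictBox k m a ∧ (k < a → ∀ i, p i ≠ a) := by
  constructor
  · rintro ⟨h1, h2, h3⟩
    refine ⟨by simpa using h3 0, ⟨?_, ?_, ?_⟩, ?_⟩
    · intro i j hij
      simpa using h1 (Fin.succ_le_succ_iff.2 hij)
    · intro i j hij hk
      simpa using h2 i.succ j.succ (by simpa using hij) (by simpa using hk)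
    · intro i
      simpa using h1 (Fin.zero_le i.succ)
    · intro hk i
      simpa using (h2 0 i.succ (Fin.succ_ne_zero i).symm (by simpa using hk)).symm
  · rintro ⟨h0, ⟨h1, h2, h3⟩, h4⟩
    refine ⟨?_, ?_, ?_⟩
    · intro i j hij
      induction i using Fin.cases <;> induction j using Fin.cases
      · simp
      · simpa using h3 _
      · exact absurd hij (by simp)
      · simpa using h1 (Fin.succ_le_succ_iff.1 hij)
    · intro i j hij hk
      induction i using Fin.cases <;> induction j using Fin.cases
      · exact absurd rfl hij
      · simpa using (h4 (by simpa using hk) _).symm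
      · rename_i i
        simp only [Fin.cons_succ, Fin.cons_zero] at hk ⊢
        exact h4 (hk.trans_le (h3 i)) i
      · simpa using h2 _ _ (by simpa using hij) (by simpa using hk)
    · intro i
      induction i using Fin.cases
      · simpa using h0
      · simpa using (h3 _).trans h0

theorem mem_kStrictBox_sub_one {k m b : ℕ} {p : Fin m → ℕ} :
    p ∈ KStrictBox k m b ↔ p ∈ KStrictBox k m (b + 1) ∧ ∀ i, p i ≠ b + 1 := by
  constructor
  · rintro ⟨h1, h2, h3⟩
    exact ⟨⟨h1, h2, fun i => (h3 i).trans b.le_succ⟩, fun i => by have := h3 i; omega⟩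
  · rintro ⟨⟨h1, h2, h3⟩, h4⟩
    exact ⟨h1, h2, fun i => by have := h3 i; have := h4 i; omega⟩

theorem forall_ne_of_head_ne {k m b : ℕ} {a : ℕ} {p : Fin m → ℕ}
    (h : (Fin.cons a p : Fin (m + 1) → ℕ) ∈ KStrictBox k (m + 1) b) (ha : a ≠ b) :
    ∀ i, (Fin.cons a p : Fin (m + 1) → ℕ) i ≠ b := by
  obtain ⟨h1, h2, -⟩ := cons_mem_kStrictBox.1 h
  intro i
  induction i using Fin.cases with
  | zero => simpa using ha
  | succ i => have := h2.2.2 i; simp only [Fin.cons_succ]; omega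

theorem kStrictBox_succ_small {k m b : ℕ} (hb : b + 1 ≤ k) :
    KStrictBox k (m + 1) (b + 1) =
      KStrictBox k (m + 1) b ∪
        (fun p : Fin m → ℕ => (Fin.cons (b + 1) p : Fin (m + 1) → ℕ)) ''
          KStrictBox k m (b + 1) := by
  ext p
  constructor
  · intro h
    induction p using Fin.consCases with
    | cons a p =>
      by_cases ha : a = b + 1
      · subst ha
        exact Or.inr ⟨p, (cons_mem_kStrictBox.1 h).2.1, rfl⟩
      · exact Or.inl (mem_kStrictBox_sub_one.2 ⟨h, forall_ne_of_head_ne h ha⟩)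
  · rintro (h | ⟨p, h, rfl⟩)
    · exact (mem_kStrictBox_sub_one.1 h).1
    · exact cons_mem_kStrictBox.2 ⟨le_rfl, h, fun h' => by omega⟩

theorem kStrictBox_succ_large {k m b : ℕ} (hb : k ≤ b) :
    KStrictBox k (m + 1) (b + 1) =
      KStrictBox k (m + 1) b ∪
        (fun p : Fin m → ℕ => (Fin.cons (b + 1) p : Fin (m + 1) → ℕ)) '' KStrictBox k m b := by
  ext p
  constructor
  · intro h
    induction p using Fin.consCases with
    | cons a p =>
      by_cases ha : a = b + 1
      · subst ha
        obtain ⟨-, h1, h2⟩ := cons_mem_kStrictBox.1 h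
        exact Or.inr ⟨p, mem_kStrictBox_sub_one.2 ⟨h1, h2 (by omega)⟩, rfl⟩
      · exact Or.inl (mem_kStrictBox_sub_one.2 ⟨h, forall_ne_of_head_ne h ha⟩)
  · rintro (h | ⟨p, h, rfl⟩)
    · exact (mem_kStrictBox_sub_one.1 h).1
    · obtain ⟨h1, h2⟩ := mem_kStrictBox_sub_one.1 h
      exact cons_mem_kStrictBox.2 ⟨le_rfl, h1, fun _ => h2⟩

theorem ncard_union_cons_image {m a : ℕ} {s : Set (Fin (m + 1) → ℕ)} {t : Set (Fin m → ℕ)}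
    (hs : s.Finite) (ht : t.Finite) (h : ∀ p ∈ s, p 0 ≠ a) :
    (s ∪ (fun p : Fin m → ℕ => (Fin.cons a p : Fin (m + 1) → ℕ)) '' t).ncard =
      s.ncard + t.ncard := by
  rw [Set.ncard_union_eq _ hs (ht.image _),
    Set.ncard_image_of_injective _ (Fin.cons_right_injective (α := fun _ => ℕ) a)]
  rw [Set.disjoint_left]
  rintro _ hp ⟨q, -, rfl⟩
  exact h _ hp (by simp)

theorem ncard_kStrictBox_zero (k b : ℕ) : (KStrictBox k 0 b).ncard = 1 := by
  rw [Set.ncard_eq_one]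
  refine ⟨Fin.elim0, Set.eq_singleton_iff_unique_mem.2
    ⟨⟨fun i => i.elim0, fun i => i.elim0, fun i => i.elim0⟩, fun p _ => Subsingleton.elim _ _⟩⟩

theorem ncard_kStrictBox_small {k b : ℕ} (hb : b ≤ k) (m : ℕ) :
    (KStrictBox k m b).ncard = (m + b).choose b := by
  induction b generalizing m with
  | zero =>
    rw [Nat.choose_zero_right, Set.ncard_eq_one]
    refine ⟨fun _ => 0, Set.eq_singleton_iff_unique_mem.2
      ⟨⟨fun _ _ _ => le_rfl, fun _ _ _ h => by simp at h, fun _ => le_rfl⟩, ?_⟩⟩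
    intro p hp
    funext i
    exact Nat.le_zero.1 (hp.2.2 i)
  | succ b ihb =>
    induction m with
    | zero => simp [ncard_kStrictBox_zero]
    | succ m ihm =>
      rw [kStrictBox_succ_small hb, ncard_union_cons_image (KStrictBox.finite _ _ _)
        (KStrictBox.finite _ _ _) (fun p hp => (mem_kStrictBox_sub_one.1 hp).2 0), ihm,
        ihb (by omega), show m + 1 + (b + 1) = (m + 1 + b) + 1 by ring, Nat.choose_succ_succ,
        show m + (b + 1) = m + 1 + b by ring]

theorem ncard_kStrictBox_succ {k m r : ℕ} :
    (KStrictBox k (m + 1) (k + (r + 1))).ncard =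
      (KStrictBox k (m + 1) (k + r)).ncard + (KStrictBox k m (k + r)).ncard := by
  rw [← add_assoc, kStrictBox_succ_large (Nat.le_add_right k r),
    ncard_union_cons_image (KStrictBox.finite _ _ _) (KStrictBox.finite _ _ _)
      (fun p hp => (mem_kStrictBox_sub_one.1 hp).2 0)]

theorem ncard_kStrictBox (k m r : ℕ) :
    (KStrictBox k m (k + r)).ncard =
      ∑ s ∈ Finset.range (m + 1), r.choose s * (m - s + k).choose k := by
  induction r generalizing m with
  | zero =>
    rw [Finset.sum_eq_single_of_mem 0 (by simp)]
    · simpa using ncard_kStrictBox_small le_rfl m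
    · intro s _ hs
      obtain ⟨t, rfl⟩ := Nat.exists_eq_succ_of_ne_zero hs
      simp
  | succ r ih =>
    cases m with
    | zero => simp [ncard_kStrictBox_zero]
    | succ m =>
      rw [ncard_kStrictBox_succ, ih, ih, Finset.sum_range_succ' _ (m + 1),
        Finset.sum_range_succ' _ (m + 1)]
      simp only [Nat.choose_succ_succ, add_mul, Finset.sum_add_distrib, Nat.choose_zero_right,
        Nat.add_sub_add_right]
      ring

theorem ncard_kStrictBox_diagonal (k m : ℕ) :
    (KStrictBox k m (k + (m + k))).ncard = (m + k).choose k * 2 ^ m := by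
  rw [ncard_kStrictBox, ← Nat.sum_range_choose, Finset.mul_sum]
  refine Finset.sum_congr rfl fun s hs => ?_
  have hs : s ≤ m := by simpa [Nat.lt_succ_iff] using hs
  have h := Nat.choose_mul (n := m + k) hs
  have e1 : (m + k).choose k = (m + k).choose m := (Nat.choose_symm_add).symm
  have e2 : (m - s + k).choose k = (m + k - s).choose (m - s) := by
    rw [show m + k - s = m - s + k by omega, ← Nat.choose_symm_add]
  rw [e1, e2, h]

theorem ncard_kStrictBoxWithPart (k m r : ℕ) :
    (KStrictBoxWithPart k (m + 1) (k + r)).ncard = (KStrictBox k m (k + r)).ncard := by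
  induction r generalizing m with
  | zero =>
    have h : KStrictBoxWithPart k (m + 1) (k + 0) =
        (fun p : Fin m → ℕ => (Fin.cons k p : Fin (m + 1) → ℕ)) '' KStrictBox k m (k + 0) := by
      ext p
      constructor
      · rintro ⟨h, i, hi⟩
        induction p using Fin.consCases with
        | cons a p =>
          by_cases ha : a = k
          · subst ha
            exact ⟨p, (cons_mem_kStrictBox.1 h).2.1, rfl⟩
          · exact absurd hi (forall_ne_of_head_ne h ha i)
      · rintro ⟨p, h, rfl⟩
        exact ⟨cons_mem_kStrictBox.2 ⟨le_rfl, h, fun h' => by omega⟩, 0, by simp⟩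
    rw [h, Set.ncard_image_of_injective _ (Fin.cons_right_injective (α := fun _ => ℕ) k)]
  | succ r ih =>
    have h : KStrictBoxWithPart k (m + 1) (k + (r + 1)) =
        KStrictBoxWithPart k (m + 1) (k + r) ∪
          (fun p : Fin m → ℕ => (Fin.cons (k + r + 1) p : Fin (m + 1) → ℕ)) ''
            KStrictBoxWithPart k m (k + r) := by
      ext p
      simp only [KStrictBoxWithPart, ← add_assoc, Set.mem_ofPred_eq,
        kStrictBox_succ_large (Nat.le_add_right k r), Set.mem_union, Set.mem_image, or_and_right]
      refine or_congr_right ?_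
      constructor
      · rintro ⟨⟨p, hp, rfl⟩, i, hi⟩
        refine ⟨p, ⟨hp, ?_⟩, rfl⟩
        induction i using Fin.cases with
        | zero => simp only [Fin.cons_zero] at hi; omega
        | succ i => exact ⟨i, by simpa using hi⟩
      · rintro ⟨p, ⟨hp, i, hi⟩, rfl⟩
        exact ⟨⟨p, hp, rfl⟩, i.succ, by simpa using hi⟩
    rw [h, ncard_union_cons_image (KStrictBoxWithPart.finite _ _ _)
      (KStrictBoxWithPart.finite _ _ _)
      (fun p hp => (mem_kStrictBox_sub_one.1 hp.1).2 0), ih]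
    cases m with
    | zero =>
      have : KStrictBoxWithPart k 0 (k + r) = ∅ := by
        ext p
        simp [KStrictBoxWithPart]
      simp [this, ncard_kStrictBox_zero]
    | succ m => rw [ih, ncard_kStrictBox_succ]

theorem typedKStrict_eq_union (n k : ℕ) :
    {p | TypedKStrictRect n k p} =
      (fun p => (p, 0)) '' (KStrictBox k (n - k) (n + k - 1) \
        KStrictBoxWithPart k (n - k) (n + k - 1)) ∪
      ((fun p => (p, 1)) '' KStrictBoxWithPart k (n - k) (n + k - 1) ∪
        (fun p => (p, 2)) '' KStrictBoxWithPart k (n - k) (n + k - 1)) := by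
  ext ⟨p, t⟩
  simp only [Set.mem_ofPred_eq, TypedKStrictRect, KStrictBox, KStrictBoxWithPart, Set.mem_union,
    Set.mem_image, Set.mem_sdiff, Prod.mk.injEq]
  constructor
  · rintro ⟨h1, h2, h3, h4, h5⟩
    interval_cases t
    · exact Or.inl ⟨p, ⟨⟨h1, h2, h3⟩, fun h => by simpa using h5.2 h.2⟩, rfl, rfl⟩
    · exact Or.inr (Or.inl ⟨p, ⟨⟨h1, h2, h3⟩, h5.1 (by simp)⟩, rfl, rfl⟩)
    · exact Or.inr (Or.inr ⟨p, ⟨⟨h1, h2, h3⟩, h5.1 (by simp)⟩, rfl, rfl⟩)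
  · rintro (⟨q, ⟨h, h'⟩, rfl, rfl⟩ | ⟨q, ⟨h, h'⟩, rfl, rfl⟩ | ⟨q, ⟨h, h'⟩, rfl, rfl⟩)
    · exact ⟨h.1, h.2.1, h.2.2, by simp, by simpa using fun i hi => h' ⟨h, i, hi⟩⟩
    · exact ⟨h.1, h.2.1, h.2.2, by simp, by simpa using h'⟩
    · exact ⟨h.1, h.2.1, h.2.2, by simp, by simpa using h'⟩

theorem typedKStrict_finite (n k : ℕ) : {p | TypedKStrictRect n k p}.Finite := by
  rw [typedKStrict_eq_union]
  exact ((KStrictBox.finite _ _ _).sdiff.image _).union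
    (((KStrictBoxWithPart.finite _ _ _).image _).union
      ((KStrictBoxWithPart.finite _ _ _).image _))

theorem ncard_typedKStrict (m k : ℕ) (hm : 1 ≤ m) :
    {p | TypedKStrictRect (m + k) k p}.ncard = (m + k).choose k * 2 ^ m := by
  have hX := KStrictBox.finite k (m + k - k) (m + k + k - 1)
  have hY := KStrictBoxWithPart.finite k (m + k - k) (m + k + k - 1)
  have hsub : KStrictBoxWithPart k (m + k - k) (m + k + k - 1) ⊆
    KStrictBox k (m + k - k) (m + k + k - 1) := fun _ hp => hp.1
  have hinj : ∀ t : ℕ, Function.Injective fun p : Fin (m + k - k) → ℕ => (p, t) :=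
    fun t p q h => (Prod.mk.inj h).1
  rw [typedKStrict_eq_union, Set.ncard_union_eq _ (hX.sdiff.image _)
    ((hY.image _).union (hY.image _)), Set.ncard_union_eq _ (hY.image _) (hY.image _),
    Set.ncard_image_of_injective _ (hinj 0), Set.ncard_image_of_injective _ (hinj 1),
    Set.ncard_image_of_injective _ (hinj 2), ← add_assoc, Set.ncard_sdiff_add_ncard_of_subset hsub hX]
  · rw [Nat.add_sub_cancel, ← ncard_kStrictBox_diagonal]
    obtain ⟨m, rfl⟩ := Nat.exists_eq_add_of_le' hm
    rw [show m + 1 + k + k - 1 = k + (m + k) by omega, ncard_kStrictBoxWithPart,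
      show m + 1 + k = m + k + 1 by omega, ncard_kStrictBox_succ]
  · rw [Set.disjoint_left]
    rintro _ ⟨p, -, rfl⟩ ⟨q, -, h⟩
    simp at h
  · rw [Set.disjoint_left]
    rintro _ ⟨p, -, rfl⟩ (⟨q, -, h⟩ | ⟨q, -, h⟩) <;> simp at h

/-- The sets of `m` elements of `{±1, …, ±n}` without two opposite elements. -/
def SignedSubsets (n m : ℕ) : Set (Finset ℤ) :=
  {S | S.card = m ∧ (∀ a ∈ S, 1 ≤ |a| ∧ |a| ≤ n) ∧ ∀ a ∈ S, -a ∉ S}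

theorem SignedSubsets.abs_injOn {n m : ℕ} {S : Finset ℤ} (hS : S ∈ SignedSubsets n m) :
    Set.InjOn (fun a : ℤ => |a|) S := by
  intro a ha b hb hab
  rcases abs_eq_abs.1 hab with h | h
  · exact h
  · exact absurd (by simpa [h] using ha) (hS.2.2 b hb)

theorem encard_signedSubsets (n m : ℕ) :
    (SignedSubsets n m).encard = (n.choose m * 2 ^ m : ℕ) := by
  let T : Finset (Σ _ : Finset ℤ, Finset ℤ) :=
    (Finset.powersetCard m (Finset.Icc (1 : ℤ) n)).sigma fun A => A.powerset
  have hT : T.card = n.choose m * 2 ^ m := by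
    rw [Finset.card_sigma, Finset.sum_congr rfl (g := fun _ => 2 ^ m)]
    · simp
    · intro A hA
      rw [Finset.card_powerset, (Finset.mem_powersetCard.1 hA).2]
  rw [← hT, ← Set.encard_coe_eq_coe_finsetCard]
  suffices h : Set.BijOn
      (fun S => (⟨S.image (fun a => |a|), (S.filter (· < 0)).image (- ·)⟩ :
        Σ _ : Finset ℤ, Finset ℤ)) (SignedSubsets n m) T by
    rw [← h.image_eq, h.injOn.encard_image]
  refine ⟨?_, ?_, ?_⟩
  · intro S hS
    have hinj := SignedSubsets.abs_injOn hS
    obtain ⟨h1, h2, h3⟩ := hS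
    simp only [T, Finset.coe_sigma, Set.mem_sigma_iff, Finset.mem_coe, Finset.mem_powersetCard,
      Finset.mem_powerset]
    refine ⟨⟨?_, ?_⟩, ?_⟩
    · intro x hx
      obtain ⟨a, ha, rfl⟩ := Finset.mem_image.1 hx
      exact Finset.mem_Icc.2 (h2 a ha)
    · rw [Finset.card_image_of_injOn hinj, h1]
    · intro x hx
      obtain ⟨a, ha, rfl⟩ := Finset.mem_image.1 hx
      obtain ⟨ha, ha'⟩ := Finset.mem_filter.1 ha
      exact Finset.mem_image.2 ⟨a, ha, abs_of_neg ha'⟩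
  · intro S hS S' hS' h
    simp only [Sigma.mk.injEq, heq_eq_eq] at h
    obtain ⟨hA, hN⟩ := h
    have key : ∀ S S' : Finset ℤ, S ∈ SignedSubsets n m →
        S.image (fun a => |a|) = S'.image (fun a => |a|) →
        (S.filter (· < 0)).image (- ·) = (S'.filter (· < 0)).image (- ·) → S ⊆ S' := by
      intro S S' hS hA hN a ha
      rcases lt_or_ge a 0 with h0 | h0
      · have : -a ∈ (S'.filter (· < 0)).image (- ·) :=
          hN ▸ Finset.mem_image_of_mem _ (Finset.mem_filter.2 ⟨ha, h0⟩)
        obtain ⟨b, hb, hab⟩ := Finset.mem_image.1 this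
        rw [neg_inj] at hab
        exact hab ▸ (Finset.mem_filter.1 hb).1
      · have : |a| ∈ S'.image (fun a => |a|) :=
          hA ▸ Finset.mem_image_of_mem (fun a : ℤ => |a|) ha
        obtain ⟨b, hb, hab⟩ := Finset.mem_image.1 this
        rcases lt_or_ge b 0 with h1 | h1
        · have : -b ∈ (S.filter (· < 0)).image (- ·) :=
            hN ▸ Finset.mem_image_of_mem _ (Finset.mem_filter.2 ⟨hb, h1⟩)
          obtain ⟨c, hc, hcb⟩ := Finset.mem_image.1 this
          rw [neg_inj] at hcb
          obtain ⟨hc, -⟩ := Finset.mem_filter.1 hc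
          simp only [abs_of_neg h1, abs_of_nonneg h0] at hab
          exact absurd hc (by rw [hcb, show b = -a by omega]; exact hS.2.2 a ha)
        · simp only [abs_of_nonneg h1, abs_of_nonneg h0] at hab
          exact hab ▸ hb
    exact Finset.Subset.antisymm (key S S' hS hA hN) (key S' S hS' hA.symm hN.symm)
  · rintro ⟨A, N⟩ h
    simp only [T, Finset.coe_sigma, Set.mem_sigma_iff, Finset.mem_coe, Finset.mem_powersetCard,
      Finset.mem_powerset] at h
    obtain ⟨⟨hA, hc⟩, hN⟩ := h
    have hpos : ∀ a ∈ A, 1 ≤ a ∧ a ≤ n := fun a ha => Finset.mem_Icc.1 (hA ha)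
    let g : ℤ → ℤ := fun a => if a ∈ N then -a else a
    have hg : ∀ a ∈ A, |g a| = a := by
      intro a ha
      have := hpos a ha
      simp only [g]
      split_ifs
      · rw [abs_neg, abs_of_nonneg (by omega)]
      · rw [abs_of_nonneg (by omega)]
    refine ⟨A.image g, ⟨?_, ?_, ?_⟩, ?_⟩
    · rw [Finset.card_image_of_injOn, hc]
      intro a ha b hb hab
      rw [← hg a ha, ← hg b hb, hab]
    · intro x hx
      obtain ⟨a, ha, rfl⟩ := Finset.mem_image.1 hx
      rw [hg a ha]
      exact hpos a ha
    · intro x hx hx'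
      obtain ⟨a, ha, rfl⟩ := Finset.mem_image.1 hx
      obtain ⟨b, hb, hab⟩ := Finset.mem_image.1 hx'
      have : b = a := by rw [← hg a ha, ← hg b hb, hab, abs_neg]
      subst this
      have h1 := hg b hb
      have h2 := hpos b hb
      have h3 : g b = 0 := by omega
      rw [h3] at h1
      simp only [abs_zero] at h1
      omega
    · simp only [Sigma.mk.injEq, heq_eq_eq]
      constructor
      · rw [Finset.image_image]
        ext x
        simp only [Finset.mem_image, Function.comp]
        constructor
        · rintro ⟨a, ha, rfl⟩
          rwa [hg a ha]
        · intro hx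
          exact ⟨x, hx, hg x hx⟩
      · ext x
        simp only [Finset.mem_image, Finset.mem_filter]
        constructor
        · rintro ⟨_, ⟨⟨a, ha, rfl⟩, h0⟩, rfl⟩
          have := hpos a ha
          simp only [g] at h0 ⊢
          split_ifs at h0 ⊢ with haN
          · simpa using haN
          · omega
        · intro hx
          have := hpos x (hN hx)
          exact ⟨-x, ⟨⟨x, hN hx, by simp [g, hx]⟩, by omega⟩, by simp⟩

theorem eqOn_of_strictMonoOn_image_eq {a b : ℤ} {f g : ℤ → ℤ}
    (hf : StrictMonoOn f (Set.Icc a b)) (hg : StrictMonoOn g (Set.Icc a b))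
    (h : f '' Set.Icc a b = g '' Set.Icc a b) : Set.EqOn f g (Set.Icc a b) := by
  have key : ∀ j : ℕ, ∀ i : ℤ, i = a + j → i ∈ Set.Icc a b → f i = g i := by
    intro j
    induction j using Nat.strong_induction_on with
    | _ j ih =>
      intro i hij hi
      have ih' : ∀ l ∈ Set.Icc a b, l < i → f l = g l := by
        intro l hl hli
        have := hl.1
        exact ih (l - a).toNat (by omega) l (by omega) hl
      rcases lt_trichotomy (f i) (g i) with hlt | heq | hgt
      · obtain ⟨l, hl, hl'⟩ : f i ∈ g '' Set.Icc a b := h ▸ Set.mem_image_of_mem f hi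
        have hli : l < i := (hg.lt_iff_lt hl hi).1 (by omega)
        exact absurd (hf hl hi hli) (by rw [ih' l hl hli, hl']; exact lt_irrefl _)
      · exact heq
      · obtain ⟨l, hl, hl'⟩ : g i ∈ f '' Set.Icc a b := h ▸ Set.mem_image_of_mem g hi
        have hli : l < i := (hf.lt_iff_lt hl hi).1 (by omega)
        exact absurd (hg hl hi hli) (by rw [← ih' l hl hli, hl']; exact lt_irrefl _)
  intro i hi
  have := hi.1
  exact key (i - a).toNat i (by omega) hi

theorem strictMonoOn_Icc_of_lt_add_one {a b : ℤ} {f : ℤ → ℤ}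
    (h : ∀ i, a ≤ i → i + 1 ≤ b → f i < f (i + 1)) : StrictMonoOn f (Set.Icc a b) := by
  have key : ∀ d : ℕ, ∀ i, a ≤ i → i + (d + 1) ≤ b → f i < f (i + (d + 1)) := by
    intro d
    induction d with
    | zero => intro i hi hb; simpa using h i hi (by simpa using hb)
    | succ d ih =>
      intro i hi hb
      push_cast at hb ⊢
      have h1 := ih i hi (by omega)
      have h2 := h (i + (d + 1)) (by omega) (by omega)
      rw [← add_assoc i (d + 1 : ℤ) 1]
      exact h1.trans h2
  intro i hi j hj hij
  have := key (j - i - 1).toNat i hi.1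
  have e : i + (((j - i - 1).toNat : ℤ) + 1) = j := by omega
  rw [e] at this
  exact this hj.2

theorem exists_strictMonoOn_image_eq (S : Finset ℤ) {a b : ℤ} (h : b - a + 1 = S.card) :
    ∃ f : ℤ → ℤ, StrictMonoOn f (Set.Icc a b) ∧ (Finset.Icc a b).image f = S := by
  let e := S.orderEmbOfFin rfl
  let f : ℤ → ℤ := fun i => if hi : (i - a).toNat < S.card then e ⟨(i - a).toNat, hi⟩ else 0
  have hf : ∀ i (hi : i ∈ Set.Icc a b), f i = e ⟨(i - a).toNat, by
      have := hi.1; have := hi.2; omega⟩ := by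
    rintro i ⟨h1, h2⟩
    exact dif_pos _
  refine ⟨f, ?_, ?_⟩
  · intro i hi j hj hij
    rw [hf i hi, hf j hj]
    refine e.strictMono ?_
    have := hi.1
    simp only [Fin.mk_lt_mk]
    omega
  · ext x
    simp only [Finset.mem_image, Finset.mem_Icc]
    constructor
    · rintro ⟨i, hi, rfl⟩
      rw [hf i hi]
      exact S.orderEmbOfFin_mem rfl _
    · intro hx
      have : x ∈ Set.range e := by rw [Finset.range_orderEmbOfFin]; exact hx
      obtain ⟨⟨j, hj⟩, rfl⟩ := this
      refine ⟨a + j, by omega, ?_⟩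
      rw [hf _ ⟨by omega, by omega⟩]
      simp

theorem exists_odd_perm_extending {n : ℕ} {u : ℤ → ℤ}
    (h : ∀ i ∈ Set.Icc (1 : ℤ) n, 1 ≤ |u i| ∧ |u i| ≤ n)
    (hinj : Set.InjOn (fun i => |u i|) (Set.Icc (1 : ℤ) n)) :
    ∃ w : Equiv.Perm ℤ, (∀ a, w (-a) = -w a) ∧ (∀ a : ℤ, (n : ℤ) < |a| → w a = a) ∧
      ∀ i ∈ Set.Icc (1 : ℤ) n, w i = u i := by
  let g : ℤ → ℤ := fun i =>
    if 1 ≤ i ∧ i ≤ n then u i else if 1 ≤ -i ∧ -i ≤ n then -u (-i) else i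
  have g1 : ∀ i ∈ Set.Icc (1 : ℤ) n, g i = u i := fun i hi => if_pos hi
  have g2 : ∀ i ∈ Set.Icc (1 : ℤ) n, g (-i) = -u i := by
    intro i hi
    have := hi.1
    simp only [g]
    rw [if_neg (by omega), if_pos (by simpa using hi), neg_neg]
  have g3 : ∀ i : ℤ, ¬ (1 ≤ i ∧ i ≤ n) → ¬ (1 ≤ -i ∧ -i ≤ n) → g i = i := by
    intro i h1 h2
    simp only [g]
    rw [if_neg h1, if_neg h2]
  have hodd : ∀ a, g (-a) = -g a := by
    intro a
    by_cases h1 : 1 ≤ a ∧ a ≤ n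
    · rw [g1 a h1, g2 a h1]
    · by_cases h2 : 1 ≤ -a ∧ -a ≤ n
      · rw [g1 _ h2]
        conv_rhs => rw [← neg_neg a, g2 _ h2, neg_neg]
      · rw [g3 a h1 h2, g3 (-a) h2 (by rwa [neg_neg])]
  have hfix : ∀ a : ℤ, ¬ (1 ≤ |a| ∧ |a| ≤ n) → g a = a := by
    intro a ha
    apply g3 <;> intro h' <;> apply ha
    · rw [abs_of_nonneg (by omega)]; exact h'
    · rw [abs_of_nonpos (by omega)]; exact h'
  have hcases : ∀ a : ℤ, 1 ≤ |a| ∧ |a| ≤ n →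
      (1 ≤ a ∧ a ≤ n) ∨ ∃ b, (1 ≤ b ∧ b ≤ (n : ℤ)) ∧ a = -b := by
    intro a ha
    rcases abs_cases a with ⟨h1, h2⟩ | ⟨h1, h2⟩
    · left; omega
    · right; exact ⟨-a, by omega, by omega⟩
  have habs : ∀ a : ℤ, 1 ≤ |a| ∧ |a| ≤ n → |g a| = |u (|a|)| := by
    intro a ha
    rcases hcases a ha with h1 | ⟨b, h1, rfl⟩
    · rw [g1 a h1, abs_of_nonneg (show 0 ≤ a by omega)]
    · rw [g2 b h1, abs_neg, abs_neg, abs_of_nonneg (show 0 ≤ b by omega)]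
  have hginj : Function.Injective g := by
    intro a b hab
    by_cases ha : 1 ≤ |a| ∧ |a| ≤ n <;> by_cases hb : 1 ≤ |b| ∧ |b| ≤ n
    · have h1 : |a| = |b| := hinj ha hb (by
        change |u (|a|)| = |u (|b|)|
        rw [← habs a ha, ← habs b hb, hab])
      rcases abs_eq_abs.1 h1 with h2 | h2
      · exact h2
      · subst h2
        rw [hodd] at hab
        have h3 : g b = 0 := by omega
        have h4 := habs b hb
        have h5 := h _ hb
        rw [h3, abs_zero] at h4
        omega
    · have h4 := habs a ha
      have h5 := h _ ha
      rw [← h4, hab, hfix b hb] at h5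
      exact absurd h5 hb
    · have h4 := habs b hb
      have h5 := h _ hb
      rw [← h4, ← hab, hfix a ha] at h5
      exact absurd h5 ha
    · rwa [hfix a ha, hfix b hb] at hab
  have hmaps : Set.MapsTo g (Finset.Icc (-n : ℤ) n) (Finset.Icc (-n : ℤ) n) := by
    intro a ha
    by_cases h0 : 1 ≤ |a| ∧ |a| ≤ n
    · have h4 := habs a h0
      have h5 := (h _ h0).2
      rw [← h4, abs_le] at h5
      simpa using h5
    · rwa [hfix a h0]
  have hsurj : Function.Surjective g := by
    intro y
    by_cases hy : |y| ≤ n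
    · obtain ⟨a, -, ha⟩ := Finset.surjOn_of_injOn_of_card_le g hmaps hginj.injOn le_rfl
        (show y ∈ (Finset.Icc (-n : ℤ) n : Set ℤ) by simpa using abs_le.1 hy)
      exact ⟨a, ha⟩
    · exact ⟨y, hfix y fun h' => hy h'.2⟩
  exact ⟨Equiv.ofBijective g ⟨hginj, hsurj⟩, hodd, fun a ha => hfix a (by omega), g1⟩

theorem apply_zero_of_odd {w : Equiv.Perm ℤ} (h : ∀ a, w (-a) = -w a) : w 0 = 0 := by
  have := h 0
  rw [neg_zero] at this
  omega

theorem one_le_abs_apply {w : Equiv.Perm ℤ} (h : ∀ a, w (-a) = -w a) {i : ℤ} (hi : i ≠ 0) :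
    1 ≤ |w i| := by
  have h0 : w i ≠ 0 := fun h' => hi (w.injective (h'.trans (apply_zero_of_odd h).symm))
  exact Int.one_le_abs h0

theorem abs_apply_le {n : ℕ} {w : Equiv.Perm ℤ} (h : ∀ a : ℤ, (n : ℤ) < |a| → w a = a) {i : ℤ}
    (hi : |i| ≤ n) : |w i| ≤ n := by
  by_contra! h'
  have := w.injective (h _ h')
  rw [this] at h'
  omega

theorem eq_of_abs_apply_eq {w : Equiv.Perm ℤ} (h : ∀ a, w (-a) = -w a) {i j : ℤ} (hi : 0 < i)
    (hj : 0 < j) (hij : |w i| = |w j|) : i = j := by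
  rcases abs_eq_abs.1 hij with h' | h'
  · exact w.injective h'
  · rw [← h] at h'
    have := w.injective h'
    omega

theorem IsKGrassmannianD.pos {n k : ℕ} {w : Equiv.Perm ℤ} (hw : IsKGrassmannianD n k w) {i : ℤ}
    (h2 : 2 ≤ i) (hik : i ≤ k) : 0 < w i := by
  obtain ⟨h, h', -⟩ := hw
  have h1 := h (by omega)
  have h3 := (strictMonoOn_Icc_of_lt_add_one h').monotoneOn ⟨le_rfl, by omega⟩ ⟨h2, hik⟩ h2
  have := abs_nonneg (w 1)
  omega

theorem IsKGrassmannianD.strictMonoOn_abs {n k : ℕ} {w : Equiv.Perm ℤ}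
    (hw : IsKGrassmannianD n k w) :
    StrictMonoOn (fun i => |w i|) (Set.Icc (1 : ℤ) k) := by
  apply strictMonoOn_Icc_of_lt_add_one
  intro i hi hik
  rcases eq_or_lt_of_le hi with rfl | hi'
  · have h := hw.1 (by omega)
    rwa [show (1 : ℤ) + 1 = 2 by norm_num, abs_of_pos (hw.pos le_rfl (by omega))]
  · rw [abs_of_pos (hw.pos (by omega) (by omega)), abs_of_pos (hw.pos (by omega) hik)]
    exact hw.2.1 i (by omega) hik

theorem card_neg_eq_succ_of_flip {n : ℕ} {u v : ℤ → ℤ} (hn : 1 ≤ n) (hu : 0 < u 1) (hv : v 1 < 0)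
    (h : ∀ i ∈ Set.Icc (2 : ℤ) n, u i = v i) :
    ((Finset.Icc (1 : ℤ) n).filter (fun i => v i < 0)).card =
      ((Finset.Icc (1 : ℤ) n).filter (fun i => u i < 0)).card + 1 := by
  rw [← Finset.card_insert_of_notMem (a := (1 : ℤ)) (by simp; omega)]
  congr 1
  ext i
  simp only [Finset.mem_filter, Finset.mem_Icc, Finset.mem_insert]
  constructor
  · rintro ⟨hi, h'⟩
    by_cases h1 : i = 1
    · exact Or.inl h1
    · exact Or.inr ⟨hi, by rwa [h i ⟨by omega, hi.2⟩]⟩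
  · rintro (rfl | ⟨hi, h'⟩)
    · exact ⟨⟨le_rfl, by omega⟩, hv⟩
    · have h1 : i ≠ 1 := by rintro rfl; omega
      exact ⟨hi, by rwa [← h i ⟨by omega, hi.2⟩]⟩

theorem apply_one_eq_of_even {n : ℕ} (hn : 1 ≤ n) {w w' : Equiv.Perm ℤ}
    (hw : w ∈ EvenSignedPerms n) (hw' : w' ∈ EvenSignedPerms n)
    (h : ∀ i ∈ Set.Icc (2 : ℤ) n, w i = w' i) (h1 : |w 1| = |w' 1|) : w 1 = w' 1 := by
  rcases abs_eq_abs.1 h1 with h1 | h1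
  · exact h1
  · have h0 := one_le_abs_apply hw.1 one_ne_zero
    rcases lt_or_ge (w 1) 0 with h2 | h2
    · have := card_neg_eq_succ_of_flip hn (by omega) h2 fun i hi => (h i hi).symm
      have e1 := hw.2.2
      have e2 := hw'.2.2
      rw [this] at e1
      exact absurd e2 (by simpa [Nat.even_add_one] using e1)
    · rw [abs_of_nonneg h2] at h0
      have := card_neg_eq_succ_of_flip hn (by omega) (show w' 1 < 0 by omega) h
      have e1 := hw.2.2
      have e2 := hw'.2.2
      rw [this] at e2
      exact absurd e1 (by simpa [Nat.even_add_one] using e2)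

theorem eq_of_eqOn_Icc {n : ℕ} {w w' : Equiv.Perm ℤ} (hw : w ∈ EvenSignedPerms n)
    (hw' : w' ∈ EvenSignedPerms n) (h : Set.EqOn w w' (Set.Icc (1 : ℤ) n)) : w = w' := by
  ext a
  by_cases ha : (n : ℤ) < |a|
  · rw [hw.2.1 a ha, hw'.2.1 a ha]
  · rcases lt_trichotomy a 0 with h0 | rfl | h0
    · rw [abs_of_neg h0] at ha
      have := h (show -a ∈ Set.Icc (1 : ℤ) n from ⟨by omega, by omega⟩)
      rw [hw.1, hw'.1] at this
      omega
    · rw [apply_zero_of_odd hw.1, apply_zero_of_odd hw'.1]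
    · rw [abs_of_pos h0] at ha
      exact h ⟨by omega, by omega⟩

theorem abs_image_Icc_eq {m k : ℕ} {w : Equiv.Perm ℤ} (hw : w ∈ EvenSignedPerms (m + k)) :
    (Finset.Icc (1 : ℤ) k).image (fun i => |w i|) =
      Finset.Icc (1 : ℤ) (m + k : ℕ) \
        ((Finset.Icc (k + 1 : ℤ) (m + k : ℕ)).image w).image (fun a => |a|) := by
  apply Finset.eq_of_subset_of_card_le
  · intro x hx
    obtain ⟨i, hi, rfl⟩ := Finset.mem_image.1 hx
    rw [Finset.mem_Icc] at hi
    rw [Finset.mem_sdiff, Finset.mem_Icc]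
    refine ⟨⟨one_le_abs_apply hw.1 (by omega), abs_apply_le hw.2.1 ?_⟩, ?_⟩
    · rw [abs_of_pos (by omega)]
      push_cast
      omega
    · intro h
      obtain ⟨_, h', e⟩ := Finset.mem_image.1 h
      obtain ⟨j, hj, rfl⟩ := Finset.mem_image.1 h'
      rw [Finset.mem_Icc] at hj
      have := eq_of_abs_apply_eq hw.1 (by omega) (by omega) e
      omega
  · rw [Finset.image_image, Finset.card_sdiff_of_subset, Finset.card_image_of_injOn,
      Finset.card_image_of_injOn]
    · simp
      omega
    · intro i hi j hj h
      rw [Finset.mem_coe, Finset.mem_Icc] at hi hj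
      exact eq_of_abs_apply_eq hw.1 (by omega) (by omega) h
    · intro i hi j hj h
      rw [Finset.mem_coe, Finset.mem_Icc] at hi hj
      exact eq_of_abs_apply_eq hw.1 (by omega) (by omega) h
    · intro x hx
      obtain ⟨i, hi, rfl⟩ := Finset.mem_image.1 hx
      rw [Finset.mem_Icc] at hi
      rw [Finset.mem_Icc]
      refine ⟨one_le_abs_apply hw.1 (by omega), abs_apply_le hw.2.1 ?_⟩
      rw [abs_of_pos (by omega)]
      omega

theorem mapsTo_signedSubsets (m k : ℕ) :
    Set.MapsTo (fun w : Equiv.Perm ℤ => (Finset.Icc (k + 1 : ℤ) (m + k : ℕ)).image w)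
      {w | w ∈ EvenSignedPerms (m + k) ∧ IsKGrassmannianD (m + k) k w}
      (SignedSubsets (m + k) m) := by
  rintro w ⟨hw, -⟩
  refine ⟨?_, ?_, ?_⟩
  · rw [Finset.card_image_of_injective _ w.injective]
    simp
  · intro x hx
    obtain ⟨i, hi, rfl⟩ := Finset.mem_image.1 hx
    rw [Finset.mem_Icc] at hi
    refine ⟨one_le_abs_apply hw.1 (by omega), abs_apply_le hw.2.1 ?_⟩
    rw [abs_of_pos (by omega)]
    omega
  · intro x hx hx'
    obtain ⟨i, hi, rfl⟩ := Finset.mem_image.1 hx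
    obtain ⟨j, hj, hij⟩ := Finset.mem_image.1 hx'
    rw [Finset.mem_Icc] at hi hj
    rw [← hw.1] at hij
    have := w.injective hij
    omega

theorem injOn_signedSubsets {m k : ℕ} (hk : 1 ≤ k) :
    Set.InjOn (fun w : Equiv.Perm ℤ => (Finset.Icc (k + 1 : ℤ) (m + k : ℕ)).image w)
      {w | w ∈ EvenSignedPerms (m + k) ∧ IsKGrassmannianD (m + k) k w} := by
  rintro w ⟨hw, hg⟩ w' ⟨hw', hg'⟩ h
  simp only at h
  have htail : Set.EqOn w w' (Set.Icc (k + 1 : ℤ) (m + k : ℕ)) := by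
    refine eqOn_of_strictMonoOn_image_eq (strictMonoOn_Icc_of_lt_add_one hg.2.2)
      (strictMonoOn_Icc_of_lt_add_one hg'.2.2) ?_
    simpa using congrArg (fun S : Finset ℤ => (S : Set ℤ)) h
  have habs : Set.EqOn (fun i => |w i|) (fun i => |w' i|) (Set.Icc (1 : ℤ) k) := by
    refine eqOn_of_strictMonoOn_image_eq hg.strictMonoOn_abs hg'.strictMonoOn_abs ?_
    have := (abs_image_Icc_eq hw).trans ((congrArg _ (by rw [h])).trans (abs_image_Icc_eq hw').symm)
    simpa using congrArg (fun S : Finset ℤ => (S : Set ℤ)) this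
  have htwo : ∀ i ∈ Set.Icc (2 : ℤ) (m + k : ℕ), w i = w' i := by
    rintro i ⟨h2, hi⟩
    by_cases hik : i ≤ k
    · have := habs (show i ∈ Set.Icc (1 : ℤ) k from ⟨by omega, hik⟩)
      simpa only [abs_of_pos (hg.pos h2 hik), abs_of_pos (hg'.pos h2 hik)] using this
    · exact htail ⟨by omega, hi⟩
  refine eq_of_eqOn_Icc hw hw' fun i hi => ?_
  by_cases h1 : i = 1
  · subst h1
    exact apply_one_eq_of_even (by omega) hw hw' htwo (habs ⟨le_rfl, by omega⟩)
  · exact htwo i ⟨by have := hi.1; omega, hi.2⟩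

theorem surjOn_signedSubsets {m k : ℕ} (hk : 1 ≤ k) :
    Set.SurjOn (fun w : Equiv.Perm ℤ => (Finset.Icc (k + 1 : ℤ) (m + k : ℕ)).image w)
      {w | w ∈ EvenSignedPerms (m + k) ∧ IsKGrassmannianD (m + k) k w}
      (SignedSubsets (m + k) m) := by
  intro S hS
  have hinjS := SignedSubsets.abs_injOn hS
  obtain ⟨hcard, hbd, -⟩ := hS
  set C := Finset.Icc (1 : ℤ) (m + k : ℕ) \ S.image (fun a => |a|) with hC
  have hCcard : C.card = k := by
    rw [hC, Finset.card_sdiff_of_subset, Finset.card_image_of_injOn hinjS, hcard]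
    · simp
      omega
    · intro x hx
      obtain ⟨a, ha, rfl⟩ := Finset.mem_image.1 hx
      exact Finset.mem_Icc.2 (hbd a ha)
  obtain ⟨c, hc, hcC⟩ := exists_strictMonoOn_image_eq C (a := 1) (b := k) (by omega)
  obtain ⟨s, hs, hsS⟩ := exists_strictMonoOn_image_eq S (a := k + 1) (b := (m + k : ℕ))
    (by omega)
  have hc_mem : ∀ i, 1 ≤ i → i ≤ (k : ℤ) → c i ∈ C := fun i h1 h2 =>
    hcC ▸ Finset.mem_image_of_mem c (Finset.mem_Icc.2 ⟨h1, h2⟩)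
  have hs_mem : ∀ i, (k + 1 : ℤ) ≤ i → i ≤ (m + k : ℕ) → s i ∈ S := fun i h1 h2 =>
    hsS ▸ Finset.mem_image_of_mem s (Finset.mem_Icc.2 ⟨h1, h2⟩)
  have hc_pos : ∀ i, 1 ≤ i → i ≤ (k : ℤ) → 1 ≤ c i ∧ c i ≤ (m + k : ℕ) := fun i h1 h2 =>
    Finset.mem_Icc.1 (Finset.mem_sdiff.1 (hc_mem i h1 h2)).1
  have hcs : ∀ i j, 1 ≤ i → i ≤ (k : ℤ) → (k + 1 : ℤ) ≤ j → j ≤ (m + k : ℕ) → c i ≠ |s j| :=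
    fun i j h1 h2 h3 h4 h => (Finset.mem_sdiff.1 (hc_mem i h1 h2)).2
      (h ▸ Finset.mem_image_of_mem (fun a : ℤ => |a|) (hs_mem j h3 h4))
  let u : ℤ → ℤ := fun i => if i ≤ k then c i else s i
  have uc : ∀ i, i ≤ (k : ℤ) → u i = c i := fun i hi => if_pos hi
  have us : ∀ i, (k + 1 : ℤ) ≤ i → u i = s i := fun i hi => if_neg (by omega)
  have ubd : ∀ i ∈ Set.Icc (1 : ℤ) (m + k : ℕ), 1 ≤ |u i| ∧ |u i| ≤ (m + k : ℕ) := by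
    rintro i ⟨h1, h2⟩
    by_cases hik : i ≤ k
    · rw [uc i hik, abs_of_pos (by have := hc_pos i h1 hik; omega)]
      exact hc_pos i h1 hik
    · rw [us i (by omega)]
      exact hbd _ (hs_mem i (by omega) h2)
  have uinj : Set.InjOn (fun i => |u i|) (Set.Icc (1 : ℤ) (m + k : ℕ)) := by
    rintro i ⟨h1, h2⟩ j ⟨h3, h4⟩ hij
    simp only at hij
    by_cases hik : i ≤ k <;> by_cases hjk : j ≤ k
    · rw [uc i hik, uc j hjk, abs_of_pos (by have := hc_pos i h1 hik; omega),
        abs_of_pos (by have := hc_pos j h3 hjk; omega)] at hij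
      exact hc.injOn ⟨h1, hik⟩ ⟨h3, hjk⟩ hij
    · rw [uc i hik, us j (by omega), abs_of_pos (by have := hc_pos i h1 hik; omega)] at hij
      exact absurd hij (hcs i j h1 hik (by omega) h4)
    · rw [us i (by omega), uc j hjk,
        abs_of_pos (a := c j) (by have := hc_pos j h3 hjk; omega)] at hij
      exact absurd hij.symm (hcs j i h3 hjk (by omega) h2)
    · rw [us i (by omega), us j (by omega)] at hij
      exact hs.injOn ⟨by omega, h2⟩ ⟨by omega, h4⟩
        (hinjS (hs_mem i (by omega) h2) (hs_mem j (by omega) h4) hij)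
  -- any sign change of `u` at `1` with an even number of negative values does the job
  have key : ∀ v : ℤ → ℤ, (∀ i, |v i| = |u i|) → (∀ i, i ≠ 1 → v i = u i) →
      Even ((Finset.Icc (1 : ℤ) (m + k : ℕ)).filter (fun i => v i < 0)).card →
      S ∈ (fun w : Equiv.Perm ℤ => (Finset.Icc (k + 1 : ℤ) (m + k : ℕ)).image w) ''
        {w | w ∈ EvenSignedPerms (m + k) ∧ IsKGrassmannianD (m + k) k w} := by
    intro v habs hv heven
    obtain ⟨w, hodd, hfix, hwv⟩ := exists_odd_perm_extending (n := m + k) (u := v)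
      (by simpa only [habs] using ubd) (by simpa only [habs] using uinj)
    have hwc : ∀ i, 2 ≤ i → i ≤ (k : ℤ) → w i = c i := fun i h1 h2 => by
      rw [hwv i ⟨by omega, by push_cast; omega⟩, hv i (by omega), uc i h2]
    have hws : ∀ i, (k + 1 : ℤ) ≤ i → i ≤ (m + k : ℕ) → w i = s i := fun i h1 h2 => by
      rw [hwv i ⟨by omega, h2⟩, hv i (by omega), us i h1]
    refine ⟨w, ⟨⟨hodd, hfix, ?_⟩, ?_, ?_, ?_⟩, ?_⟩
    · rwa [Finset.filter_congr fun i hi => by rw [hwv i (Finset.mem_Icc.1 hi)]]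
    · intro h2
      rw [hwc 2 le_rfl (by omega), hwv 1 ⟨le_rfl, by omega⟩, habs, uc 1 (by omega),
        abs_of_pos (by have := hc_pos 1 le_rfl (by omega); omega)]
      exact hc ⟨le_rfl, by omega⟩ ⟨by omega, by omega⟩ (by omega)
    · intro i h1 h2
      rw [hwc i h1 (by omega), hwc (i + 1) (by omega) h2]
      exact hc ⟨by omega, by omega⟩ ⟨by omega, by omega⟩ (by omega)
    · intro i h1 h2
      rw [hws i h1 (by omega), hws (i + 1) (by omega) h2]
      exact hs ⟨by omega, by omega⟩ ⟨by omega, by omega⟩ (by omega)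
    · rw [← hsS]
      refine Finset.image_congr fun i hi => ?_
      rw [Finset.mem_coe, Finset.mem_Icc] at hi
      exact hws i hi.1 hi.2
  by_cases heven : Even ((Finset.Icc (1 : ℤ) (m + k : ℕ)).filter (fun i => u i < 0)).card
  · exact key u (fun _ => rfl) (fun _ _ => rfl) heven
  · have hu1 : 0 < u 1 := by
      rw [uc 1 (by omega)]
      have := hc_pos 1 le_rfl (by omega)
      omega
    refine key (Function.update u 1 (-u 1)) ?_ (fun i hi => Function.update_of_ne hi _ _) ?_
    · intro i
      by_cases hi : i = 1
      · subst hi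
        rw [Function.update_self, abs_neg]
      · rw [Function.update_of_ne hi]
    · rw [card_neg_eq_succ_of_flip (u := u) (by omega) hu1 (by rw [Function.update_self]; omega)]
      · exact Nat.even_add_one.2 heven
      · rintro i ⟨hi, -⟩
        rw [Function.update_of_ne (by omega)]

/-- the `k`-Grassmannian elements of `W̃_n` are in bijection
with the typed `k`-strict partitions whose diagram fits in an
`(n−k) × (n+k−1)` rectangle. -/
theorem kGrassmannianD_bijection_typedKStrict (n k : ℕ) (hk1 : 1 ≤ k) (hk2 : k ≤ n - 1)
    (hn : 1 ≤ n) :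
    ∃ f : Equiv.Perm ℤ → (Fin (n - k) → ℕ) × ℕ,
      Set.BijOn f {w | w ∈ EvenSignedPerms n ∧ IsKGrassmannianD n k w}
        {p | TypedKStrictRect n k p} := by
  obtain ⟨m, rfl⟩ : ∃ m, n = m + k := ⟨n - k, by omega⟩
  have hbij : Set.BijOn (fun w : Equiv.Perm ℤ => (Finset.Icc (k + 1 : ℤ) (m + k : ℕ)).image w)
      {w | w ∈ EvenSignedPerms (m + k) ∧ IsKGrassmannianD (m + k) k w}
      (SignedSubsets (m + k) m) :=
    ⟨mapsTo_signedSubsets m k, injOn_signedSubsets hk1, surjOn_signedSubsets hk1⟩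
  have hcard : {w | w ∈ EvenSignedPerms (m + k) ∧ IsKGrassmannianD (m + k) k w}.encard =
      ((m + k).choose m * 2 ^ m : ℕ) := by
    rw [← hbij.injOn.encard_image, hbij.image_eq, encard_signedSubsets]
  refine Set.Finite.exists_bijOn_of_encard_eq
    (Set.finite_of_encard_eq_coe hcard) ?_
  rw [hcard, ← (typedKStrict_finite (m + k) k).cast_ncard_eq, ncard_typedKStrict m k (by omega),
    Nat.choose_symm_add]
end
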